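/- Let kₙ(x) := ⌊n!/2 + x·√(n!/4)⌋ for x ∈ ℝ, let Λₙ := (1/n!²)·binom(n!, n!/2), and set Bₙ(x) := T(n, kₙ(x))/Λₙ, where T(n,k) := 0 whenever k < 0 or k > n!. Then Bₙ(x) converges to exp(−x²/2) uniformly over x ∈ ℝ as n → ∞; that is, sup_{x∈ℝ} |Bₙ(x) − exp(−x²/2)| → 0 as n → ∞. -/

import Mathlib

open Equiv Finset

/-- Two `k`-subsets of `Sₙ` are equivalent if one is obtained from the other by
two-sided multiplication `σ ↦ g₁ * σ * g₂` for some pair `(g₁, g₂)`. -/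
def permSetRel (n k : ℕ) (x y : {s : Finset (Perm (Fin n)) // s.card = k}) : Prop :=
  ∃ g₁ g₂ : Perm (Fin n),
    (x : Finset (Perm (Fin n))).image (fun σ => g₁ * σ * g₂) = (y : Finset (Perm (Fin n)))

/-- `T n k` is the number of orbits of the action of `Sₙ × Sₙ` on the family of
`k`-element subsets of `Sₙ`. -/
noncomputable def T (n k : ℕ) : ℕ := Nat.card (Quot (permSetRel n k))

/-- `kₙ(x) = ⌊n!/2 + x·√(n!/4)⌋`. -/
noncomputable def kIdx (n : ℕ) (x : ℝ) : ℤ :=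
  ⌊(n.factorial : ℝ) / 2 + x * Real.sqrt ((n.factorial : ℝ) / 4)⌋

/-- `T(n,k)` extended to integer `k`, with value `0` for `k < 0` (and automatically `0`
for `k > n!`, since there are no `k`-subsets of `Sₙ`). -/
noncomputable def Tz (n : ℕ) (k : ℤ) : ℕ := if 0 ≤ k then T n k.toNat else 0

/-- `Λₙ = (1/n!²)·binom(n!, n!/2)`. -/
noncomputable def Lam (n : ℕ) : ℝ :=
  (n.factorial.choose (n.factorial / 2) : ℝ) / (n.factorial : ℝ) ^ 2

/-- `Bₙ(x) = T(n, kₙ(x)) / Λₙ`. -/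
noncomputable def B (n : ℕ) (x : ℝ) : ℝ := (Tz n (kIdx n x) : ℝ) / Lam n



lemma fix_card_le {α : Type*} [Fintype α] [DecidableEq α] (f : Perm α)
    (h : 2 * (univ.filter (fun x => f x = x)).card ≤ Fintype.card α) :
    (univ.filter (fun s : Finset α => s.image f = s)).card
      ≤ 2 ^ (Fintype.card α - Fintype.card α / 6) := by
  classical
  let P : Finset (Finset α) := univ.filter (fun I => ∀ x ∈ I, f x ∉ I)
  have hP : P.Nonempty := ⟨∅, by simp [P]⟩
  obtain ⟨I, hI, hmax⟩ := P.exists_max_image Finset.card hP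
  have hI' : ∀ x ∈ I, f x ∉ I := by simpa [P] using hI
  have hcov : univ.filter (fun x => ¬ f x = x) ⊆ (I ∪ I.image f) ∪ I.image f.symm := by
    intro x hx
    simp only [mem_filter, mem_univ, true_and] at hx
    by_contra hc
    simp only [mem_union, mem_image, not_or, not_exists, not_and] at hc
    obtain ⟨⟨h1, h2⟩, h3⟩ := hc
    have : insert x I ∈ P := by
      simp only [P, mem_filter, mem_univ, true_and, mem_insert]
      rintro y (rfl | hy) (h | h)
      · exact hx h
      · exact h3 _ h (by simp)
      · exact h2 y hy h
      · exact hI' y hy h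
    have := hmax _ this
    rw [card_insert_of_notMem h1] at this
    omega
  have hc1 := card_le_card hcov
  have hc2 := card_union_le (I ∪ I.image f) (I.image f.symm)
  have hc3 := card_union_le I (I.image f)
  have hc4 : (I.image f).card ≤ I.card := card_image_le
  have hc5 : (I.image f.symm).card ≤ I.card := card_image_le
  have hc6 := card_filter_add_card_filter_not (s := (univ : Finset α)) (fun x => f x = x)
  rw [card_univ] at hc6
  have hIc : Fintype.card α / 6 ≤ I.card := by omega
  have key : (univ.filter (fun s : Finset α => s.image f = s)).card ≤ (Iᶜ.powerset).card := by
    apply card_le_card_of_injOn (fun s => s \ I)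
    · intro s _
      simp only [coe_powerset, Set.mem_preimage, Set.mem_powerset_iff, coe_subset]
      intro x hx
      simp only [mem_sdiff] at hx
      simp [hx.2]
    · intro s hs t ht hst
      have hs' : s.image f = s := by simpa using hs
      have ht' : t.image f = t := by simpa using ht
      have e1 : ∀ x, f x ∈ s ↔ x ∈ s := fun x => by
        conv_lhs => rw [← hs']
        simp
      have e2 : ∀ x, f x ∈ t ↔ x ∈ t := fun x => by
        conv_lhs => rw [← ht']
        simp
      have e3 : ∀ x, x ∉ I → (x ∈ s ↔ x ∈ t) := fun x hx => by
        have := congrArg (fun u => x ∈ u) hst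
        simpa [hx] using this
      ext x
      by_cases hx : x ∈ I
      · rw [← e1, ← e2]; exact e3 _ (hI' x hx)
      · exact e3 _ hx
  refine key.trans ?_
  rw [card_powerset, card_compl]
  exact Nat.pow_le_pow_right (by norm_num) (by omega)

lemma fix_half {n : ℕ} (hn : 3 ≤ n) (g₁ g₂ : Perm (Fin n)) (h : ¬ (g₁ = 1 ∧ g₂ = 1)) :
    2 * (univ.filter (fun σ : Perm (Fin n) => g₁ * σ * g₂ = σ)).card
      ≤ Fintype.card (Perm (Fin n)) := by
  classical
  set F := univ.filter (fun σ : Perm (Fin n) => g₁ * σ * g₂ = σ) with hF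
  by_cases h1 : g₁ = 1
  · have : F = ∅ := by
      rw [hF, filter_eq_empty_iff]
      intro σ _ hs
      subst h1
      apply h
      simpa using hs
    simp [this]
  · have : ∃ τ : Perm (Fin n), g₁ * τ ≠ τ * g₁ := by
      have : ∃ a, g₁ a ≠ a := by
        by_contra hc
        push Not at hc
        exact h1 (Equiv.ext hc)
      obtain ⟨a, ha⟩ := this
      obtain ⟨c, hc1, hc2⟩ := Fin.exists_ne_and_ne_of_two_lt a (g₁ a) (by omega)
      refine ⟨swap (g₁ a) c, fun h => ?_⟩
      have := congrArg (fun p : Perm (Fin n) => p a) h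
      simp only [Perm.mul_apply, swap_apply_left] at this
      rw [swap_apply_of_ne_of_ne ha.symm hc1.symm] at this
      exact hc2 this.symm
    obtain ⟨τ, hτ⟩ := this
    have hd : Disjoint F (F.image (fun σ => τ * σ)) := by
      rw [disjoint_left]
      intro σ hs hs'
      simp only [hF, mem_filter, mem_univ, true_and, mem_image] at hs hs'
      obtain ⟨ρ, hr, rfl⟩ := hs'
      apply hτ
      have : g₁ * τ * (ρ * g₂) = τ * g₁ * (ρ * g₂) := by
        calc _ = g₁ * (τ * ρ) * g₂ := by group
          _ = τ * (g₁ * ρ * g₂) := by rw [hs, hr]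
          _ = _ := by group
      exact mul_right_cancel this
    have hc := card_le_univ (F ∪ F.image (fun σ => τ * σ))
    rw [card_union_of_disjoint hd, card_image_of_injective _ (mul_right_injective τ)] at hc
    omega

/-- The action of pairs on `k`-subsets. -/
@[reducible] def pairAct (n k : ℕ) : MulAction (Perm (Fin n) × Perm (Fin n))
    {s : Finset (Perm (Fin n)) // s.card = k} where
  smul g x := ⟨x.1.image (fun σ => g.1 * σ * g.2⁻¹), by
    rw [card_image_of_injective, x.2]
    intro a b h
    simpa using h⟩
  one_smul x := by
    apply Subtype.ext
    change x.1.image (fun σ => 1 * σ * 1⁻¹) = x.1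
    simp
  mul_smul g h x := by
    apply Subtype.ext
    change x.1.image (fun σ => (g.1 * h.1) * σ * (g.2 * h.2)⁻¹) =
      (x.1.image (fun σ => h.1 * σ * h.2⁻¹)).image (fun σ => g.1 * σ * g.2⁻¹)
    rw [image_image]
    refine congrArg (fun f => x.1.image f) ?_
    funext σ
    simp [mul_assoc]

lemma burnside_T (n k : ℕ) :
    T n k * (n.factorial) ^ 2 = ∑ g : Perm (Fin n) × Perm (Fin n),
      (univ.filter (fun x : {s : Finset (Perm (Fin n)) // s.card = k} =>
        x.1.image (fun σ => g.1 * σ * g.2⁻¹) = x.1)).card := by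
  classical
  let _ := pairAct n k
  have hq : T n k = Nat.card (Quotient (MulAction.orbitRel (Perm (Fin n) × Perm (Fin n))
      {s : Finset (Perm (Fin n)) // s.card = k})) := by
    unfold T
    apply Nat.card_congr
    refine Quot.congr (Equiv.refl _) ?_
    intro x y
    rw [← Setoid.comm']
    change permSetRel n k x y ↔ ∃ g : Perm (Fin n) × Perm (Fin n), g • x = y
    constructor
    · rintro ⟨g₁, g₂, h⟩
      refine ⟨(g₁, g₂⁻¹), Subtype.ext ?_⟩
      change x.1.image (fun σ => g₁ * σ * g₂⁻¹⁻¹) = y.1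
      simpa using h
    · rintro ⟨⟨g₁, g₂⟩, h⟩
      refine ⟨g₁, g₂⁻¹, ?_⟩
      exact congrArg Subtype.val h
  have hb := MulAction.sum_card_fixedBy_eq_card_orbits_mul_card_group
    (Perm (Fin n) × Perm (Fin n)) {s : Finset (Perm (Fin n)) // s.card = k}
  rw [hq, Nat.card_eq_fintype_card]
  have hc : Fintype.card (Perm (Fin n) × Perm (Fin n)) = n.factorial ^ 2 := by
    simp [Fintype.card_perm, sq]
  rw [hc] at hb
  rw [← hb]
  refine Finset.sum_congr rfl fun g _ => ?_
  rw [Fintype.card_subtype]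
  congr 1
  ext x
  simp only [mem_filter, mem_univ, true_and, MulAction.mem_fixedBy]
  exact Subtype.ext_iff

lemma T_bounds {n : ℕ} (hn : 3 ≤ n) (k : ℕ) :
    n.factorial.choose k ≤ T n k * n.factorial ^ 2 ∧
    T n k * n.factorial ^ 2 ≤ n.factorial.choose k +
      n.factorial ^ 2 * 2 ^ (n.factorial - n.factorial / 6) := by
  classical
  rw [burnside_T]
  have hN : Fintype.card (Perm (Fin n)) = n.factorial := by simp [Fintype.card_perm]
  rw [← Finset.add_sum_erase _ _ (mem_univ (1 : Perm (Fin n) × Perm (Fin n)))]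
  have h1 : (univ.filter (fun x : {s : Finset (Perm (Fin n)) // s.card = k} =>
        x.1.image (fun σ => (1 : Perm (Fin n) × Perm (Fin n)).1 * σ *
          (1 : Perm (Fin n) × Perm (Fin n)).2⁻¹) = x.1)).card = n.factorial.choose k := by
    have : (univ.filter (fun x : {s : Finset (Perm (Fin n)) // s.card = k} =>
        x.1.image (fun σ => (1 : Perm (Fin n) × Perm (Fin n)).1 * σ *
          (1 : Perm (Fin n) × Perm (Fin n)).2⁻¹) = x.1)) = univ := by
      simp
    rw [this, card_univ, Fintype.card_finset_len, hN]
  rw [h1]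
  refine ⟨Nat.le_add_right _ _, Nat.add_le_add_left ?_ _⟩
  have hle : ∀ g ∈ (univ : Finset (Perm (Fin n) × Perm (Fin n))).erase 1,
      (univ.filter (fun x : {s : Finset (Perm (Fin n)) // s.card = k} =>
        x.1.image (fun σ => g.1 * σ * g.2⁻¹) = x.1)).card
        ≤ 2 ^ (n.factorial - n.factorial / 6) := by
    intro g hg
    have hg1 : ¬ (g.1 = 1 ∧ g.2⁻¹ = 1) := by
      rintro ⟨h, h'⟩
      exact (mem_erase.1 hg).1 (Prod.ext h (by simpa using h'))
    let f : Perm (Perm (Fin n)) := (Equiv.mulLeft g.1).trans (Equiv.mulRight g.2⁻¹)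
    have hf : ∀ σ, f σ = g.1 * σ * g.2⁻¹ := fun σ => rfl
    have h2 := fix_card_le f (by simpa only [hf] using fix_half hn g.1 g.2⁻¹ hg1)
    rw [hN] at h2
    refine le_trans ?_ h2
    apply card_le_card_of_injOn (fun x => x.1)
    · intro x hx
      simp only [coe_filter, mem_univ, true_and, Set.mem_ofPred_eq] at hx ⊢
      exact hx
    · intro x _ y _ h
      exact Subtype.ext h
  refine (Finset.sum_le_card_nsmul _ _ _ hle).trans ?_
  rw [smul_eq_mul]
  apply Nat.mul_le_mul_right
  refine (card_le_univ _).trans ?_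
  simp [Fintype.card_perm, sq]

lemma exp_cube (t : ℝ) (ht : 0 ≤ t) : Real.exp (-(t ^ 2 / 2)) * t ^ 3 ≤ 4 := by
  have h := Real.quadratic_le_exp_of_nonneg (x := t ^ 2 / 2) (by positivity)
  rw [Real.exp_neg, inv_mul_le_iff₀ (Real.exp_pos _)]
  nlinarith [mul_nonneg (sq_nonneg t) (sq_nonneg (t - 1)), sq_nonneg t, sq_nonneg (t^2)]

lemma ratio_step (M i : ℕ) (hi : i ≤ M) :
    ((2 * M).choose (M + (i + 1)) : ℝ) * (M + i + 1) = (2 * M).choose (M + i) * (M - i) := by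
  have h := Nat.choose_succ_right_eq (2 * M) (M + i)
  have h2 : 2 * M - (M + i) = M - i := by omega
  rw [h2] at h
  have h3 : (((2 * M).choose (M + i + 1) * (M + i + 1) : ℕ) : ℝ) =
    (((2 * M).choose (M + i) * (M - i) : ℕ) : ℝ) := by rw [h]
  push_cast [Nat.cast_sub hi] at h3
  exact h3

lemma ratio_upper (M j : ℕ) (hM : 0 < M) (hj : j ≤ M) :
    ((2 * M).choose (M + j) : ℝ) ≤ (2 * M).choose M * Real.exp (-((j : ℝ) ^ 2 / (M + j))) := by
  have hMr : (0 : ℝ) < M := by exact_mod_cast hM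
  have key : ∀ i : ℕ, i ≤ j →
      ((2 * M).choose (M + i) : ℝ) ≤ (2 * M).choose M * Real.exp (-((i : ℝ) ^ 2 / (M + j))) := by
    intro i
    induction i with
    | zero => intro _; simp
    | succ i ih =>
      intro hi
      have ih := ih (by omega)
      have hs := ratio_step M i (by omega)
      have hir : (i : ℝ) + 1 ≤ j := by exact_mod_cast hi
      have hjr : (j : ℝ) ≤ M := by exact_mod_cast hj
      have hi0 : (0 : ℝ) ≤ i := by positivity
      have h1 : ((2 * M).choose (M + (i + 1)) : ℝ) =
          (2 * M).choose (M + i) * ((M - i) / (M + i + 1)) := by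
        field_simp
        linarith
      have h2 : ((M : ℝ) - i) / (M + i + 1) ≤ Real.exp (-((2 * i + 1) / (M + j))) := by
        have := Real.add_one_le_exp (-((2 * (i : ℝ) + 1) / (M + j)))
        refine le_trans ?_ this
        have h3 : ((M : ℝ) - i) / (M + i + 1) = -((2 * i + 1) / (M + i + 1)) + 1 := by
          field_simp; ring
        rw [h3]
        have : (2 * (i : ℝ) + 1) / (M + j) ≤ (2 * i + 1) / (M + i + 1) := by
          apply div_le_div_of_nonneg_left <;> linarith
        linarith
      rw [h1]
      have h4 : Real.exp (-(((i + 1 : ℕ) : ℝ) ^ 2 / (M + j))) =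
          Real.exp (-((i : ℝ) ^ 2 / (M + j))) * Real.exp (-((2 * i + 1) / (M + j))) := by
        rw [← Real.exp_add]
        congr 1
        push_cast
        ring
      rw [h4, ← mul_assoc]
      apply mul_le_mul ih h2 _ (by positivity)
      apply div_nonneg <;> linarith
  exact key j le_rfl

lemma ratio_lower (M j : ℕ) (hj : j < M) :
    (2 * M).choose M * Real.exp (-((j : ℝ) ^ 2 / (M - j))) ≤ ((2 * M).choose (M + j) : ℝ) := by
  have hjr : (j : ℝ) < M := by exact_mod_cast hj
  have key : ∀ i : ℕ, i ≤ j →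
      (2 * M).choose M * Real.exp (-((i : ℝ) ^ 2 / (M - j))) ≤ ((2 * M).choose (M + i) : ℝ) := by
    intro i
    induction i with
    | zero => intro _; simp
    | succ i ih =>
      intro hi
      have ih := ih (by omega)
      have hs := ratio_step M i (by omega)
      have hir : (i : ℝ) + 1 ≤ j := by exact_mod_cast hi
      have hi0 : (0 : ℝ) ≤ i := by positivity
      have h1 : ((2 * M).choose (M + (i + 1)) : ℝ) =
          (2 * M).choose (M + i) * ((M - i) / (M + i + 1)) := by
        have : (0:ℝ) < M + i + 1 := by positivity
        field_simp
        linarith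
      have h2 : Real.exp (-((2 * i + 1) / (M - j))) ≤ ((M : ℝ) - i) / (M + i + 1) := by
        have := Real.add_one_le_exp ((2 * (i : ℝ) + 1) / (M - j))
        rw [Real.exp_neg, inv_le_comm₀ (Real.exp_pos _) (by apply div_pos <;> linarith)]
        refine le_trans ?_ this
        have h0 : (M : ℝ) - i ≠ 0 := by linarith
        have h3 : (((M : ℝ) - i) / (M + i + 1))⁻¹ = (2 * i + 1) / (M - i) + 1 := by
          rw [inv_div]
          field_simp; ring
        rw [h3]
        have : (2 * (i : ℝ) + 1) / (M - i) ≤ (2 * i + 1) / (M - j) := by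
          apply div_le_div_of_nonneg_left <;> linarith
        linarith
      rw [h1]
      have h4 : Real.exp (-(((i + 1 : ℕ) : ℝ) ^ 2 / (M - j))) =
          Real.exp (-((i : ℝ) ^ 2 / (M - j))) * Real.exp (-((2 * i + 1) / (M - j))) := by
        rw [← Real.exp_add]
        congr 1
        push_cast
        ring
      rw [h4, ← mul_assoc]
      apply mul_le_mul ih h2 (by positivity) (by positivity)
  exact key j le_rfl

lemma exp_sub_le (a b : ℝ) : Real.exp (-a) - Real.exp (-b) ≤ Real.exp (-a) * (b - a) := by
  have h := Real.add_one_le_exp (a - b)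
  have h2 : Real.exp (-b) = Real.exp (-a) * Real.exp (a - b) := by
    rw [← Real.exp_add]; congr 1; ring
  rw [h2]
  nlinarith [Real.exp_pos (-a)]

lemma local_limit (M j : ℕ) (hM : 4 ≤ M) :
    |((2 * M).choose (M + j) : ℝ) / (2 * M).choose M - Real.exp (-((j : ℝ) ^ 2 / M))|
      ≤ 8 / Real.sqrt M := by
  have hMr : (4 : ℝ) ≤ M := by exact_mod_cast hM
  have hM0 : (0 : ℝ) < M := by linarith
  set r := Real.sqrt M with hr
  have hr0 : 0 < r := Real.sqrt_pos.2 hM0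
  have hr2 : (M : ℝ) = r ^ 2 := (Real.sq_sqrt hM0.le).symm
  have hr2' : 2 ≤ r := by nlinarith
  have hC : (0 : ℝ) < (2 * M).choose M := by
    exact_mod_cast Nat.choose_pos (by omega)
  obtain ⟨t, ht⟩ : ∃ t : ℝ, t = j / r := ⟨_, rfl⟩
  have hj : (j : ℝ) = t * r := by rw [ht]; field_simp
  have ht0 : 0 ≤ t := by rw [ht]; positivity
  have hc := exp_cube t ht0
  have he1 : (j : ℝ) ^ 2 / M = t ^ 2 := by rw [hj, hr2]; field_simp
  have he2 : Real.exp (-t ^ 2) ≤ Real.exp (-(t ^ 2 / 2)) := by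
    apply Real.exp_le_exp.2; nlinarith
  rw [he1, abs_le]
  constructor
  · have hpos : (0 : ℝ) ≤ ((2 * M).choose (M + j) : ℝ) / (2 * M).choose M := by positivity
    by_cases h : 2 * j ≤ M
    · have h1 := ratio_lower M j (by omega)
      have hjM : 2 * (j : ℝ) ≤ M := by exact_mod_cast h
      have h2 : Real.exp (-((j : ℝ) ^ 2 / (M - j))) ≤
          ((2 * M).choose (M + j) : ℝ) / (2 * M).choose M := by
        rw [le_div_iff₀ hC]; linarith
      have h3 := exp_sub_le (t ^ 2) ((j : ℝ) ^ 2 / (M - j))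
      have h4 : (j : ℝ) ^ 2 / (M - j) - t ^ 2 ≤ 2 * t ^ 3 / r := by
        rw [hr2, hj] at *
        have h5 : 0 < r - t := by nlinarith
        have h5' : 2 * t ≤ r := by nlinarith
        have h6 : (t * r) ^ 2 / (r ^ 2 - t * r) - t ^ 2 = t ^ 3 / (r - t) := by
          have : r ^ 2 - t * r = r * (r - t) := by ring
          rw [this]
          field_simp
          ring
        rw [h6, div_le_div_iff₀ h5 hr0]
        nlinarith [pow_nonneg ht0 3]
      have h7 : Real.exp (-t ^ 2) * (2 * t ^ 3 / r) ≤ 8 / r := by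
        rw [mul_div_assoc', div_le_div_iff_of_pos_right hr0]
        nlinarith [pow_nonneg ht0 3]
      have h8 := mul_le_mul_of_nonneg_left h4 (Real.exp_pos (-t ^ 2)).le
      linarith
    · have hjM : (M : ℝ) < 2 * j := by
        push Not at h
        exact_mod_cast h
      rw [hr2, hj] at hjM
      have h5 : r ≤ 2 * t := by nlinarith
      have h6 : Real.exp (-t ^ 2) ≤ 8 / r := by
        rw [le_div_iff₀ hr0]
        have : r ≤ 2 * t ^ 3 := by nlinarith [mul_nonneg ht0 (by nlinarith : 0 ≤ t ^ 2 - 1)]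
        nlinarith [Real.exp_pos (-(t ^ 2 / 2))]
      linarith
  · by_cases h : j ≤ M
    · have h1 := ratio_upper M j (by omega) h
      have hjM : (j : ℝ) ≤ M := by exact_mod_cast h
      have h2 : ((2 * M).choose (M + j) : ℝ) / (2 * M).choose M ≤
          Real.exp (-((j : ℝ) ^ 2 / (M + j))) := by
        rw [div_le_iff₀ hC]; linarith
      have h3 := exp_sub_le ((j : ℝ) ^ 2 / (M + j)) (t ^ 2)
      rw [hr2, hj] at hjM
      have htr : t ≤ r := by nlinarith
      have h6 : (j : ℝ) ^ 2 / (M + j) = t ^ 2 * r / (r + t) := by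
        rw [hr2, hj]
        have : r ^ 2 + t * r = r * (r + t) := by ring
        rw [this]
        field_simp
      have h4 : t ^ 2 - (j : ℝ) ^ 2 / (M + j) ≤ t ^ 3 / r := by
        have : t ^ 2 - (j : ℝ) ^ 2 / (M + j) = t ^ 3 / (r + t) := by
          rw [h6]; field_simp; ring
        rw [this]
        apply div_le_div_of_nonneg_left <;> first | positivity | linarith
      have h5 : Real.exp (-((j : ℝ) ^ 2 / (M + j))) ≤ Real.exp (-(t ^ 2 / 2)) := by
        apply Real.exp_le_exp.2
        rw [h6, neg_le_neg_iff, div_le_div_iff₀ (by norm_num) (by positivity)]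
        nlinarith [sq_nonneg t]
      have h7 : Real.exp (-(t ^ 2 / 2)) * (t ^ 3 / r) ≤ 8 / r := by
        rw [mul_div_assoc', div_le_div_iff_of_pos_right hr0]
        linarith
      have h8 := mul_le_mul_of_nonneg_left h4 (Real.exp_pos (-((j : ℝ) ^ 2 / (M + j)))).le
      have h9 := mul_le_mul_of_nonneg_right h5 (by positivity : 0 ≤ t ^ 3 / r)
      linarith
    · rw [Nat.choose_eq_zero_of_lt (by omega)]
      have := Real.exp_pos (-t ^ 2)
      have : 0 < 8 / r := by positivity
      simp only [Nat.cast_zero, zero_div]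
      linarith

lemma gauss_lip (x y : ℝ) :
    |Real.exp (-x ^ 2 / 2) - Real.exp (-y ^ 2 / 2)| ≤ |x - y| := by
  have hd : ∀ z : ℝ, HasDerivAt (fun z : ℝ => Real.exp (-z ^ 2 / 2))
      (Real.exp (-z ^ 2 / 2) * (-z)) z := by
    intro z
    have : HasDerivAt (fun z : ℝ => -z ^ 2 / 2) (-z) z := by
      have h : HasDerivAt (fun z : ℝ => -z ^ 2 / 2) _ z :=
        ((hasDerivAt_pow 2 z).neg).div_const 2
      refine h.congr_deriv ?_
      norm_num
      try ring
    exact this.exp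
  have hb : ∀ z : ℝ, ‖Real.exp (-z ^ 2 / 2) * (-z)‖ ≤ 1 := by
    intro z
    rw [norm_mul, norm_neg, Real.norm_eq_abs, Real.norm_eq_abs, abs_of_pos (Real.exp_pos _)]
    have h := Real.add_one_le_exp (z ^ 2 / 2)
    rw [show -z ^ 2 / 2 = -(z ^ 2 / 2) by ring, Real.exp_neg, inv_mul_le_iff₀ (Real.exp_pos _)]
    nlinarith [sq_nonneg (|z| - 1), sq_abs z]
  have := convex_univ.norm_image_sub_le_of_norm_hasDerivWithin_le (𝕜 := ℝ)
    (fun z _ => (hd z).hasDerivWithinAt) (fun z _ => hb z) (Set.mem_univ y) (Set.mem_univ x)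
  simpa using this

lemma B_approx {n q : ℕ} (hn : 4 ≤ n) (hq : n.factorial = 6 * q) (x : ℝ) (d : ℕ)
    (hd : d = (kIdx n x - (3 * q : ℕ)).natAbs) :
    |B n x - ((2 * (3 * q)).choose (3 * q + d) : ℝ) / (2 * (3 * q)).choose (3 * q)|
      ≤ 36 * (q : ℝ) ^ 2 * (6 * q + 1) / 2 ^ q := by
  have hq0 : 0 < q := by have := n.factorial_pos; omega
  have hqr : (0 : ℝ) < q := by exact_mod_cast hq0
  have hN : n.factorial = 2 * (3 * q) := by omega
  have hN2 : n.factorial / 2 = 3 * q := by omega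
  have hC : (0 : ℝ) < (2 * (3 * q)).choose (3 * q) := by
    exact_mod_cast Nat.choose_pos (by omega)
  unfold B Tz Lam
  rw [hN2]
  by_cases hk : 0 ≤ kIdx n x
  · rw [if_pos hk]
    obtain ⟨k, hk'⟩ := Int.eq_ofNat_of_zero_le hk
    rw [hk'] at hd ⊢
    have hkn : ((k : ℤ)).toNat = k := by simp
    have hch : (2 * (3 * q)).choose (3 * q + d) = (2 * (3 * q)).choose k := by
      by_cases h : 3 * q ≤ k
      · congr 1; omega
      · rw [← Nat.choose_symm (by omega : k ≤ 2 * (3 * q))]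
        congr 1; omega
    obtain ⟨h1, h2⟩ := T_bounds (by omega : 3 ≤ n) k
    have h6 : n.factorial - n.factorial / 6 = 5 * q := by omega
    rw [h6] at h2
    rw [hkn, hch]
    have hmid : 2 ^ (2 * (3 * q)) ≤ (2 * (3 * q) + 1) * (2 * (3 * q)).choose (3 * q) := by
      rw [← Nat.sum_range_choose]
      have := Finset.sum_le_card_nsmul (range (2 * (3 * q) + 1))
        (fun m => (2 * (3 * q)).choose m) ((2 * (3 * q)).choose (3 * q)) (fun m _ => by
          have := Nat.choose_le_middle m (2 * (3 * q))
          rwa [Nat.mul_div_cancel_left _ (by norm_num)] at this)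
      simpa using this
    rw [hN] at h1 h2 ⊢
    have h1r : ((2 * (3 * q)).choose k : ℝ) ≤ T n k * (2 * (3 * q)) ^ 2 := by exact_mod_cast h1
    have h2r : (T n k * (2 * (3 * q)) ^ 2 : ℝ) ≤ (2 * (3 * q)).choose k +
        (2 * (3 * q)) ^ 2 * 2 ^ (5 * q) := by exact_mod_cast h2
    have hmr : (2 : ℝ) ^ (2 * (3 * q)) ≤ (2 * (3 * q) + 1) * (2 * (3 * q)).choose (3 * q) := by
      exact_mod_cast hmid
    push_cast
    generalize ((2 * (3 * q)).choose (3 * q) : ℝ) = C at *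
    generalize ((2 * (3 * q)).choose k : ℝ) = K at *
    rw [div_div_eq_mul_div, ← sub_div, abs_div, abs_of_pos hC, abs_of_nonneg (by linarith),
      div_le_div_iff₀ hC (by positivity)]
    have hp : (2 : ℝ) ^ (2 * (3 * q)) = 2 ^ (5 * q) * 2 ^ q := by
      rw [← pow_add]; congr 1; ring
    rw [hp] at hmr
    have h2q : (0 : ℝ) < 2 ^ q := by positivity
    calc _ ≤ ((2 * (3 * (q : ℝ))) ^ 2 * 2 ^ (5 * q)) * 2 ^ q := by
          apply mul_le_mul_of_nonneg_right _ h2q.le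
          linarith
      _ = (36 * (q : ℝ) ^ 2) * (2 ^ (5 * q) * 2 ^ q) := by ring
      _ ≤ (36 * (q : ℝ) ^ 2) * ((2 * (3 * q) + 1) * C) := by
          apply mul_le_mul_of_nonneg_left hmr (by positivity)
      _ = _ := by ring
  · rw [if_neg hk, Nat.choose_eq_zero_of_lt (by omega : 2 * (3 * q) < 3 * q + d)]
    simp only [Nat.cast_zero, zero_div, sub_zero, abs_zero]
    positivity

lemma x_approx {n q : ℕ} (hq0 : 0 < q) (hq : n.factorial = 6 * q) (x : ℝ) (d : ℕ)
    (hd : d = (kIdx n x - (3 * q : ℕ)).natAbs) :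
    |Real.exp (-((d : ℝ) ^ 2 / (3 * q : ℕ))) - Real.exp (-x ^ 2 / 2)|
      ≤ 1 / Real.sqrt (3 * q / 2) := by
  have hqr : (0 : ℝ) < q := by exact_mod_cast hq0
  set s := Real.sqrt (3 * q / 2) with hs
  have hs0 : 0 < s := Real.sqrt_pos.2 (by positivity)
  have hs2 : s ^ 2 = 3 * q / 2 := Real.sq_sqrt (by positivity)
  have hk : kIdx n x = ⌊(3 * q : ℝ) + x * s⌋ := by
    unfold kIdx
    rw [hq, hs]
    push_cast
    rw [show (6 * (q : ℝ)) / 2 = 3 * q by ring, show (6 * (q : ℝ)) / 4 = 3 * q / 2 by ring]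
  obtain ⟨j, hj⟩ : ∃ j : ℤ, j = kIdx n x - (3 * q : ℕ) := ⟨_, rfl⟩
  rw [← hj] at hd
  have hdj : (d : ℝ) ^ 2 = (j : ℝ) ^ 2 := by
    rw [hd, Nat.cast_natAbs, Int.cast_abs, sq_abs]
  have hjr : (j : ℝ) = (kIdx n x : ℝ) - 3 * q := by rw [hj]; push_cast; ring
  have h1 := Int.floor_le ((3 * q : ℝ) + x * s)
  have h2 := Int.lt_floor_add_one ((3 * q : ℝ) + x * s)
  rw [← hk] at h1 h2
  have he : -((d : ℝ) ^ 2 / (3 * q : ℕ)) = -((j : ℝ) / s) ^ 2 / 2 := by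
    rw [hdj, div_pow, hs2]
    push_cast
    field_simp
  rw [he]
  refine (gauss_lip _ _).trans ?_
  have : (j : ℝ) / s - x = (j - x * s) / s := by field_simp
  rw [this, abs_div, abs_of_pos hs0, div_le_div_iff_of_pos_right hs0, abs_le]
  constructor <;> linarith

lemma err_tendsto : Filter.Tendsto (fun q : ℕ => 36 * (q : ℝ) ^ 2 * (6 * q + 1) / 2 ^ q
    + 8 / Real.sqrt (3 * q : ℕ) + 1 / Real.sqrt (3 * q / 2)) Filter.atTop (nhds 0) := by
  have a3 := tendsto_pow_const_div_const_pow_of_one_lt 3 (one_lt_two : (1 : ℝ) < 2)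
  have a2 := tendsto_pow_const_div_const_pow_of_one_lt 2 (one_lt_two : (1 : ℝ) < 2)
  have h1 : Filter.Tendsto (fun q : ℕ => 36 * (q : ℝ) ^ 2 * (6 * q + 1) / 2 ^ q)
      Filter.atTop (nhds 0) := by
    have := (a3.const_mul 216).add (a2.const_mul 36)
    simp only [mul_zero, add_zero] at this
    refine this.congr fun q => ?_
    ring
  have hq : Filter.Tendsto (fun q : ℕ => (q : ℝ)) Filter.atTop Filter.atTop :=
    tendsto_natCast_atTop_atTop
  have h2 : Filter.Tendsto (fun q : ℕ => 8 / Real.sqrt (3 * q : ℕ)) Filter.atTop (nhds 0) := by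
    apply Filter.Tendsto.const_div_atTop
    apply Real.tendsto_sqrt_atTop.comp
    push_cast
    exact hq.const_mul_atTop (by norm_num)
  have h3 : Filter.Tendsto (fun q : ℕ => 1 / Real.sqrt (3 * q / 2)) Filter.atTop (nhds 0) := by
    apply Filter.Tendsto.const_div_atTop
    apply Real.tendsto_sqrt_atTop.comp
    exact (hq.const_mul_atTop (by norm_num)).atTop_div_const (by norm_num)
  simpa using (h1.add h2).add h3

/-- `Bₙ(x) → exp(−x²/2)` uniformly over `x ∈ ℝ` as `n → ∞`. -/
theorem scaling_limit :
    ∀ ε : ℝ, 0 < ε → ∃ N : ℕ, ∀ n : ℕ, N ≤ n → ∀ x : ℝ,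
      |B n x - Real.exp (-x ^ 2 / 2)| ≤ ε := by
  intro ε hε
  obtain ⟨Q, hQ⟩ := Filter.eventually_atTop.1 (err_tendsto.eventually (gt_mem_nhds hε))
  refine ⟨6 * Q + 12, fun n hn x => ?_⟩
  obtain ⟨q, hq⟩ : 6 ∣ n.factorial := by
    have : Nat.factorial 3 ∣ n.factorial := Nat.factorial_dvd_factorial (by omega)
    simpa [Nat.factorial] using this
  have hself := Nat.self_le_factorial n
  have hE := hQ q (by omega)
  have h1 := B_approx (by omega) hq x _ rfl
  have h2 := local_limit (3 * q) (kIdx n x - (3 * q : ℕ)).natAbs (by omega)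
  have h3 := x_approx (by omega) hq x _ rfl
  rw [abs_le] at *
  constructor <;> linarith [h1.1, h1.2, h2.1, h2.2, h3.1, h3.2]
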